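/- Assume (P2) with constant c₂. Then: (i) for every n ∈ ℕ and all μ, ν ∈ P(E), sup_{α∈P(E)} ‖α𝕂_μ^n − α𝕂_ν^n‖_TV ≤ c₂·n·‖μ−ν‖_TV; (ii) if in addition (P1) holds with parameters ℓ ≥ 1, ε ∈ (0,1), Ψ, then the Markov kernels R_μ := (1−ε)^{-1}(𝕂_μ^ℓ − εΨ) satisfy sup_{α∈P(E)} ‖αR_μ^n − αR_ν^n‖_TV ≤ (c₂·n·ℓ/(1−ε))·‖μ−ν‖_TV for every n ∈ ℕ and all μ, ν ∈ P(E). -/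

import Mathlib

open MeasureTheory Filter Topology
open scoped ENNReal NNReal

noncomputable section

namespace QSD

variable {E : Type*}

/-- `n`-fold iterate of a sub-Markov kernel given as a measure-valued map:
`kIter K 0 x = δ_x` and `kIter K (n+1) x = (K x).bind (kIter K n)`. -/
def kIter [MeasurableSpace E] (K : E → Measure E) : ℕ → E → Measure E
  | 0, x => Measure.dirac x
  | n + 1, x => (K x).bind (kIter K n)

/-- Total variation distance between two measures: supremum over measurable sets
of the absolute difference of the masses. -/
def tvDist [MeasurableSpace E] (μ ν : Measure E) : ℝ :=
  ⨆ A : {s : Set E // MeasurableSet s}, |(μ (A : Set E)).toReal - (ν (A : Set E)).toReal|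

/-- The kernel `A_μ(x,·) = Σ_{n≥0} K_{μ,∂}^n(x,·)`. -/
def Aker [MeasurableSpace E] (K : E → Measure E) (x : E) : Measure E :=
  Measure.sum fun n => kIter K n x

/-- `Π_μ = μ A_μ / (μ A_μ)(E)`. -/
def Pim [MeasurableSpace E] (K : E → Measure E) (μ : Measure E) : Measure E :=
  ((μ.bind (Aker K)) Set.univ)⁻¹ • μ.bind (Aker K)

/-- The kernel with redistribution (rebirth) `𝕂_μ(x,·) = K_{μ,∂}(x,·) + δ_μ(x)·μ(·)`,
where `δ_μ(x) = 1 - K_{μ,∂}(x,E)`. -/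
def Kret [MeasurableSpace E] (K : E → Measure E) (μ : Measure E) (x : E) : Measure E :=
  K x + (1 - K x Set.univ) • μ

/-- Iterated application of a family of kernels to the constant function `𝟙`:
`chainV K [μ₁,…,μ_k] x = (K_{μ₁}(K_{μ₂}(⋯(K_{μ_k} 𝟙)⋯)))(x)`. -/
def chainV {V : Type*} [MeasurableSpace V] {I : Type*} (K : I → V → Measure V) :
    List I → V → ℝ≥0∞
  | [], _ => 1
  | μ :: L, x => ∫⁻ y, chainV K L y ∂(K μ x)

end QSD

open QSD

/-- The Doeblin residual kernel `R_μ = (1−ε)⁻¹(𝕂_μ^ℓ − εΨ)`. -/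
def Rker {E : Type*} [MeasurableSpace E]
    (Kb : ProbabilityMeasure E → E → Measure E) (ℓ : ℕ) (ε : ℝ) (Ψ : Measure E)
    (μ : ProbabilityMeasure E) (x : E) : Measure E :=
  (ENNReal.ofReal (1 - ε))⁻¹ • (kIter (Kb μ) ℓ x - ENNReal.ofReal ε • Ψ)

namespace QSD

variable {E : Type*} [MeasurableSpace E]

theorem tvDist_le_of_forall {μ ν : Measure E} {d : ℝ}
    (h : ∀ A, MeasurableSet A → |μ.real A - ν.real A| ≤ d) : tvDist μ ν ≤ d := by
  have : Nonempty {s : Set E // MeasurableSet s} := ⟨⟨∅, .empty⟩⟩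
  exact ciSup_le fun A => h A A.2

theorem abs_measureReal_sub_le_tvDist (μ ν : Measure E) [IsProbabilityMeasure μ]
    [IsProbabilityMeasure ν] {A : Set E} (hA : MeasurableSet A) :
    |μ.real A - ν.real A| ≤ tvDist μ ν := by
  refine le_ciSup (f := fun A : {s : Set E // MeasurableSet s} =>
    |(μ (A : Set E)).toReal - (ν (A : Set E)).toReal|) ⟨1, ?_⟩ ⟨A, hA⟩
  rintro _ ⟨B, rfl⟩
  have h₁ : μ.real B ≤ 1 := measureReal_le_one
  have h₂ : ν.real B ≤ 1 := measureReal_le_one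
  have h₃ : 0 ≤ μ.real B := measureReal_nonneg
  have h₄ : 0 ≤ ν.real B := measureReal_nonneg
  exact abs_sub_le_iff.2 ⟨by simp only [Measure.real] at *; linarith,
    by simp only [Measure.real] at *; linarith⟩

theorem abs_integral_sub_le_tvDist (μ ν : Measure E) [IsProbabilityMeasure μ]
    [IsProbabilityMeasure ν] {f : E → ℝ} (hf : Measurable f) (h₀ : ∀ x, 0 ≤ f x)
    (h₁ : ∀ x, f x ≤ 1) : |∫ x, f x ∂μ - ∫ x, f x ∂ν| ≤ tvDist μ ν := by
  have layercake (ρ : Measure E) [IsProbabilityMeasure ρ] :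
      ∫ x, f x ∂ρ = ∫ t in Set.Ioc 0 1, ρ.real {x | t ≤ f x} := by
    have hint : Integrable f ρ := .of_bound hf.aestronglyMeasurable 1 <| .of_forall fun x => by
      rw [Real.norm_of_nonneg (h₀ x)]; exact h₁ x
    exact hint.integral_eq_integral_Ioc_meas_le (.of_forall h₀) (.of_forall h₁)
  have hint (ρ : Measure E) [IsProbabilityMeasure ρ] :
      IntegrableOn (fun t => ρ.real {x | t ≤ f x}) (Set.Ioc 0 1) := by
    have hanti : Antitone fun t => ρ.real {x | t ≤ f x} := fun s t hst =>
      measureReal_mono fun x (hx : t ≤ f x) => hst.trans hx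
    exact .of_bound (by simp) hanti.measurable.aestronglyMeasurable 1 <| .of_forall fun t => by
      rw [Real.norm_of_nonneg measureReal_nonneg]; exact measureReal_le_one
  rw [layercake μ, layercake ν, ← integral_sub (hint μ) (hint ν)]
  simpa using norm_setIntegral_le_of_norm_le_const (μ := volume) (s := Set.Ioc (0 : ℝ) 1)
    (f := fun t => μ.real {x | t ≤ f x} - ν.real {x | t ≤ f x}) (by simp) fun t _ =>
      abs_measureReal_sub_le_tvDist μ ν (measurableSet_le measurable_const hf)

theorem isProbabilityMeasure_bind (α : Measure E) [IsProbabilityMeasure α] {F : E → Measure E}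
    (hF : Measurable F) [∀ x, IsProbabilityMeasure (F x)] : IsProbabilityMeasure (α.bind F) :=
  ⟨by simp [Measure.bind_apply MeasurableSet.univ hF.aemeasurable]⟩

theorem measurable_measureReal {F : E → Measure E} (hF : Measurable F) {A : Set E}
    (hA : MeasurableSet A) : Measurable fun x => (F x).real A :=
  ((Measure.measurable_coe hA).comp hF).ennreal_toReal

theorem integrable_measureReal (α : Measure E) [IsProbabilityMeasure α] {F : E → Measure E}
    (hF : Measurable F) [∀ x, IsProbabilityMeasure (F x)] {A : Set E} (hA : MeasurableSet A) :
    Integrable (fun x => (F x).real A) α :=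
  .of_bound (measurable_measureReal hF hA).aestronglyMeasurable 1 <| .of_forall fun x => by
    rw [Real.norm_of_nonneg measureReal_nonneg]; exact measureReal_le_one

theorem measureReal_bind (α : Measure E) {F : E → Measure E}
    (hF : Measurable F) [∀ x, IsProbabilityMeasure (F x)] {A : Set E} (hA : MeasurableSet A) :
    (α.bind F).real A = ∫ x, (F x).real A ∂α := by
  rw [Measure.real, Measure.bind_apply hA hF.aemeasurable]
  exact (integral_toReal ((Measure.measurable_coe hA).comp hF).aemeasurable
    (.of_forall fun x => measure_lt_top _ _)).symm

theorem tvDist_bind_le (α β : Measure E) [IsProbabilityMeasure α] [IsProbabilityMeasure β]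
    {F G : E → Measure E} (hF : Measurable F) (hG : Measurable G)
    [∀ x, IsProbabilityMeasure (F x)] [∀ x, IsProbabilityMeasure (G x)] {d : ℝ}
    (h : ∀ x, tvDist (F x) (G x) ≤ d) :
    tvDist (α.bind F) (β.bind G) ≤ d + tvDist α β := by
  refine tvDist_le_of_forall fun A hA => ?_
  rw [measureReal_bind α hF hA, measureReal_bind β hG hA]
  refine (abs_sub_le _ (∫ x, (G x).real A ∂α) _).trans (add_le_add ?_ ?_)
  · rw [← integral_sub (integrable_measureReal α hF hA) (integrable_measureReal α hG hA)]
    simpa using norm_integral_le_of_norm_le_const (μ := α)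
      (f := fun x => (F x).real A - (G x).real A)
      (.of_forall fun x => (abs_measureReal_sub_le_tvDist (F x) (G x) hA).trans (h x))
  · exact abs_integral_sub_le_tvDist α β (measurable_measureReal hG hA)
      (fun _ => measureReal_nonneg) fun _ => measureReal_le_one

theorem tvDist_self (μ : Measure E) : tvDist μ μ = 0 := by
  simp [tvDist]

theorem measurable_kIter {K : E → Measure E} (hK : Measurable K) (n : ℕ) :
    Measurable (kIter K n) := by
  induction n with
  | zero => exact Measure.measurable_dirac
  | succ n ih => exact (Measure.measurable_bind' ih).comp hK

theorem isProbabilityMeasure_kIter {K : E → Measure E} (hK : Measurable K)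
    [∀ x, IsProbabilityMeasure (K x)] (n : ℕ) (x : E) : IsProbabilityMeasure (kIter K n x) := by
  induction n generalizing x with
  | zero => exact Measure.dirac.isProbabilityMeasure
  | succ n ih => exact isProbabilityMeasure_bind (K x) (measurable_kIter hK n)

theorem tvDist_kIter_le {K L : E → Measure E} (hK : Measurable K) (hL : Measurable L)
    [∀ x, IsProbabilityMeasure (K x)] [∀ x, IsProbabilityMeasure (L x)] {d : ℝ}
    (h : ∀ x, tvDist (K x) (L x) ≤ d) (n : ℕ) (x : E) :
    tvDist (kIter K n x) (kIter L n x) ≤ n * d := by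
  induction n generalizing x with
  | zero => simp [kIter, tvDist_self]
  | succ n ih =>
    have := isProbabilityMeasure_kIter hK n
    have := isProbabilityMeasure_kIter hL n
    have := tvDist_bind_le (K x) (L x) (measurable_kIter hK n) (measurable_kIter hL n) ih
    simp only [kIter]
    push_cast
    linarith [h x]

theorem tvDist_bind_kIter_le (α : Measure E) [IsProbabilityMeasure α] {K L : E → Measure E}
    (hK : Measurable K) (hL : Measurable L) [∀ x, IsProbabilityMeasure (K x)]
    [∀ x, IsProbabilityMeasure (L x)] {d : ℝ} (h : ∀ x, tvDist (K x) (L x) ≤ d) (n : ℕ) :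
    tvDist (α.bind (kIter K n)) (α.bind (kIter L n)) ≤ n * d := by
  have := isProbabilityMeasure_kIter hK n
  have := isProbabilityMeasure_kIter hL n
  simpa [tvDist_self] using tvDist_bind_le α α (measurable_kIter hK n) (measurable_kIter hL n)
    (tvDist_kIter_le hK hL h n)

end QSD

section Residual

variable {E : Type*} [MeasurableSpace E] {Kb : ProbabilityMeasure E → E → Measure E} {ℓ : ℕ}
  {ε : ℝ} {Ψ : Measure E} [IsProbabilityMeasure Ψ] {μ ν : ProbabilityMeasure E}

theorem Rker_apply {x : E}
    (h : ∀ A, MeasurableSet A → ENNReal.ofReal ε * Ψ A ≤ kIter (Kb μ) ℓ x A)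
    {A : Set E} (hA : MeasurableSet A) :
    Rker Kb ℓ ε Ψ μ x A =
      (ENNReal.ofReal (1 - ε))⁻¹ * (kIter (Kb μ) ℓ x A - ENNReal.ofReal ε * Ψ A) := by
  have : IsFiniteMeasure (ENNReal.ofReal ε • Ψ) := Ψ.smul_finite ENNReal.ofReal_ne_top
  rw [Rker, Measure.smul_apply, Measure.sub_apply hA (Measure.le_iff.2 h)]
  rfl

theorem measurable_Rker (hK : Measurable (Kb μ))
    (h : ∀ x A, MeasurableSet A → ENNReal.ofReal ε * Ψ A ≤ kIter (Kb μ) ℓ x A) :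
    Measurable (Rker Kb ℓ ε Ψ μ) := by
  refine Measure.measurable_of_measurable_coe _ fun A hA => ?_
  simp only [Rker_apply (h _) hA]
  exact (((Measure.measurable_coe hA).comp (measurable_kIter hK ℓ)).sub_const _).const_mul _

theorem isProbabilityMeasure_Rker (h₀ : 0 ≤ ε) (h₁ : ε < 1) {x : E}
    [IsProbabilityMeasure (kIter (Kb μ) ℓ x)]
    (h : ∀ A, MeasurableSet A → ENNReal.ofReal ε * Ψ A ≤ kIter (Kb μ) ℓ x A) :
    IsProbabilityMeasure (Rker Kb ℓ ε Ψ μ x) := by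
  refine ⟨?_⟩
  rw [Rker_apply h .univ, measure_univ, measure_univ, mul_one, ENNReal.ofReal_sub 1 h₀,
    ENNReal.ofReal_one]
  refine ENNReal.inv_mul_cancel ?_ (by finiteness)
  rw [← ENNReal.ofReal_one, ← ENNReal.ofReal_sub 1 h₀]
  simpa using h₁

theorem measureReal_Rker (h₀ : 0 ≤ ε) (h₁ : ε < 1) {x : E}
    [IsProbabilityMeasure (kIter (Kb μ) ℓ x)]
    (h : ∀ A, MeasurableSet A → ENNReal.ofReal ε * Ψ A ≤ kIter (Kb μ) ℓ x A)
    {A : Set E} (hA : MeasurableSet A) :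
    (Rker Kb ℓ ε Ψ μ x).real A = ((kIter (Kb μ) ℓ x).real A - ε * Ψ.real A) / (1 - ε) := by
  rw [Measure.real, Rker_apply h hA, ENNReal.toReal_mul,
    ENNReal.toReal_sub_of_le (h A hA) (measure_ne_top _ _), ENNReal.toReal_mul,
    ENNReal.toReal_inv, ENNReal.toReal_ofReal h₀, ENNReal.toReal_ofReal (sub_nonneg.2 h₁.le),
    inv_mul_eq_div]
  rfl

theorem tvDist_Rker_le (h₀ : 0 ≤ ε) (h₁ : ε < 1) {x : E}
    [IsProbabilityMeasure (kIter (Kb μ) ℓ x)] [IsProbabilityMeasure (kIter (Kb ν) ℓ x)]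
    (hμ : ∀ A, MeasurableSet A → ENNReal.ofReal ε * Ψ A ≤ kIter (Kb μ) ℓ x A)
    (hν : ∀ A, MeasurableSet A → ENNReal.ofReal ε * Ψ A ≤ kIter (Kb ν) ℓ x A) :
    tvDist (Rker Kb ℓ ε Ψ μ x) (Rker Kb ℓ ε Ψ ν x) ≤
      tvDist (kIter (Kb μ) ℓ x) (kIter (Kb ν) ℓ x) / (1 - ε) := by
  have hpos : 0 < 1 - ε := sub_pos.2 h₁
  refine tvDist_le_of_forall fun A hA => ?_
  rw [measureReal_Rker h₀ h₁ hμ hA, measureReal_Rker h₀ h₁ hν hA, ← sub_div,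
    sub_sub_sub_cancel_right, abs_div, abs_of_pos hpos]
  gcongr
  exact abs_measureReal_sub_le_tvDist _ _ hA

end Residual

/-- Lemma 3.5: (i) under (P2), `sup_α ‖α𝕂_μ^n − α𝕂_ν^n‖_TV ≤ c₂ n ‖μ−ν‖_TV`;
(ii) under (P1) in addition, the residual kernels `R_μ = (1−ε)⁻¹(𝕂_μ^ℓ − εΨ)` satisfy
`sup_α ‖αR_μ^n − αR_ν^n‖_TV ≤ (c₂ n ℓ/(1−ε)) ‖μ−ν‖_TV`. -/
theorem stmt9
    {E : Type*} [MeasurableSpace E]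
    (Kb : ProbabilityMeasure E → E → Measure E)
    (hKmeas : ∀ μ, Measurable (Kb μ))
    (hKmarkov : ∀ μ x, IsProbabilityMeasure (Kb μ x))
    -- (P2)
    (c₂ : ℝ) (hc₂ : 0 < c₂)
    (hP2 : ∀ (μ ν : ProbabilityMeasure E) (x : E),
      tvDist (Kb μ x) (Kb ν x) ≤ c₂ * tvDist (μ : Measure E) (ν : Measure E)) :
    -- (i)
    (∀ (n : ℕ) (μ ν α : ProbabilityMeasure E),
      tvDist ((α : Measure E).bind (kIter (Kb μ) n))
             ((α : Measure E).bind (kIter (Kb ν) n))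
        ≤ c₂ * n * tvDist (μ : Measure E) (ν : Measure E)) ∧
    -- (ii)
    (∀ ℓ : ℕ, 1 ≤ ℓ → ∀ ε : ℝ, 0 < ε → ε < 1 →
      ∀ Ψ : Measure E, IsProbabilityMeasure Ψ →
      (∀ (μ : ProbabilityMeasure E) (x : E) (A : Set E), MeasurableSet A →
        ENNReal.ofReal ε * Ψ A ≤ kIter (Kb μ) ℓ x A) →
      ∀ (n : ℕ) (μ ν α : ProbabilityMeasure E),
        tvDist ((α : Measure E).bind (kIter (Rker Kb ℓ ε Ψ μ) n))
               ((α : Measure E).bind (kIter (Rker Kb ℓ ε Ψ ν) n))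
          ≤ (c₂ * n * ℓ / (1 - ε)) * tvDist (μ : Measure E) (ν : Measure E)) := by
  refine ⟨fun n μ ν α => ?_, fun ℓ _ ε hε₀ hε₁ Ψ hΨ hP1 n μ ν α => ?_⟩
  · calc
      _ ≤ n * (c₂ * tvDist (μ : Measure E) (ν : Measure E)) :=
        tvDist_bind_kIter_le (α : Measure E) (hKmeas μ) (hKmeas ν) (hP2 μ ν) n
      _ = _ := by ring
  · have hprob (ρ : ProbabilityMeasure E) := isProbabilityMeasure_kIter (hKmeas ρ) ℓ
    have hR (ρ : ProbabilityMeasure E) (x : E) : IsProbabilityMeasure (Rker Kb ℓ ε Ψ ρ x) :=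
      have := hprob ρ x
      isProbabilityMeasure_Rker hε₀.le hε₁ (hP1 ρ x)
    have hpos : 0 < 1 - ε := sub_pos.2 hε₁
    have hdist (x : E) : tvDist (Rker Kb ℓ ε Ψ μ x) (Rker Kb ℓ ε Ψ ν x) ≤
        ℓ * (c₂ * tvDist (μ : Measure E) (ν : Measure E)) / (1 - ε) := by
      have := hprob μ x
      have := hprob ν x
      refine (tvDist_Rker_le hε₀.le hε₁ (hP1 μ x) (hP1 ν x)).trans ?_
      gcongr
      exact tvDist_kIter_le (hKmeas μ) (hKmeas ν) (hP2 μ ν) ℓ x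
    calc
      _ ≤ n * (ℓ * (c₂ * tvDist (μ : Measure E) (ν : Measure E)) / (1 - ε)) :=
        tvDist_bind_kIter_le (α : Measure E) (measurable_Rker (hKmeas μ) (hP1 μ))
          (measurable_Rker (hKmeas ν) (hP1 ν)) hdist n
      _ = _ := by ring
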